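/- arXiv:2203.11577 — 2 statements merged into one kernel-verified Lean document; each statement's English description precedes it below -/
import Mathlib

section
/- Let 𝔸 be a countable ω-categorical homogeneous relational structure with no algebraicity which is arsfacere, and let S be any submonoid of End(𝔸) satisfying Emb(𝔸) ⊆ S ⊆ End(𝔸). Then the Zariski topology on the monoid S coincides with the pointwise topology on S. -/
open Set

variable {A : Type*} {ι : Type*}

/-- `f` is a homomorphism (endomorphism) of the relational structure `(A, rel)`. -/
def IsHom (ar : ι → ℕ) (rel : ∀ i, (Fin (ar i) → A) → Prop) (f : A → A) : Prop :=
  ∀ (i : ι) (x : Fin (ar i) → A), rel i x → rel i (f ∘ x)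

/-- `f` is a self-embedding of the relational structure `(A, rel)`. -/
def IsEmb (ar : ι → ℕ) (rel : ∀ i, (Fin (ar i) → A) → Prop) (f : A → A) : Prop :=
  Function.Injective f ∧ ∀ (i : ι) (x : Fin (ar i) → A), (rel i x ↔ rel i (f ∘ x))

/-- `f` is an automorphism of the relational structure `(A, rel)`. -/
def IsAuto (ar : ι → ℕ) (rel : ∀ i, (Fin (ar i) → A) → Prop) (f : A → A) : Prop :=
  Function.Bijective f ∧ ∀ (i : ι) (x : Fin (ar i) → A), (rel i x ↔ rel i (f ∘ x))

/-- `p` is an isomorphism between induced substructures when restricted to `D`. -/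
def IsPartialIsoOn (ar : ι → ℕ) (rel : ∀ i, (Fin (ar i) → A) → Prop)
    (D : Set A) (p : A → A) : Prop :=
  Set.InjOn p D ∧
    ∀ (i : ι) (x : Fin (ar i) → A), (∀ k, x k ∈ D) → (rel i x ↔ rel i (p ∘ x))

/-- `p` is a homomorphism between induced substructures when restricted to `D`. -/
def IsPartialHomOn (ar : ι → ℕ) (rel : ∀ i, (Fin (ar i) → A) → Prop)
    (D : Set A) (p : A → A) : Prop :=
  ∀ (i : ι) (x : Fin (ar i) → A), (∀ k, x k ∈ D) → rel i x → rel i (p ∘ x)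

/-- Every isomorphism between finite induced substructures extends to an automorphism. -/
def Homogeneous (ar : ι → ℕ) (rel : ∀ i, (Fin (ar i) → A) → Prop) : Prop :=
  ∀ (D : Finset A) (p : A → A), IsPartialIsoOn ar rel ↑D p →
    ∃ g : A → A, IsAuto ar rel g ∧ ∀ a ∈ D, g a = p a

/-- Every orbit on `A \ F` of the pointwise stabiliser of a finite set `F` is infinite. -/
def NoAlgebraicity (ar : ι → ℕ) (rel : ∀ i, (Fin (ar i) → A) → Prop) : Prop :=
  ∀ (F : Finset A) (a : A), a ∉ F →
    {b : A | ∃ g : A → A, IsAuto ar rel g ∧ (∀ x ∈ F, g x = x) ∧ g a = b}.Infinite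

/-- For every `k`, the action of the automorphism group on `k`-tuples has
finitely many orbits. -/
def OmegaCategorical (ar : ι → ℕ) (rel : ∀ i, (Fin (ar i) → A) → Prop) : Prop :=
  ∀ k : ℕ,
    (Set.range fun v : Fin k → A =>
      {w : Fin k → A | ∃ g : A → A, IsAuto ar rel g ∧ w = g ∘ v}).Finite

/-- The endomorphisms of `(A, rel)`, as a set of functions. -/
def endSet (ar : ι → ℕ) (rel : ∀ i, (Fin (ar i) → A) → Prop) : Set (A → A) :=
  {f : A → A | IsHom ar rel f}

/-- The self-embeddings of `(A, rel)`, as a set of functions. -/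
def embSet (ar : ι → ℕ) (rel : ∀ i, (Fin (ar i) → A) → Prop) : Set (A → A) :=
  {f : A → A | IsEmb ar rel f}

/-- The automorphisms of `(A, rel)`, as a set of functions. -/
def autSet (ar : ι → ℕ) (rel : ∀ i, (Fin (ar i) → A) → Prop) : Set (A → A) :=
  {f : A → A | IsAuto ar rel f}

/-- `(A, rel)` is arsfacere, witnessed by the relation symbol `E`. -/
def ArsfacereWith (ar : ι → ℕ) (rel : ∀ i, (Fin (ar i) → A) → Prop) (E : ι) : Prop :=
  (∀ x : A, ¬ rel E (fun _ => x)) ∧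
  ∀ (x : A) (F : Fin (ar E) → Finset A),
    (∀ i j : Fin (ar E), i ≠ j → ((F i : Set A) ∩ (F j : Set A)) = {x}) →
    ∃ f : A → A,
      Set.InjOn f (⋃ i, (F i : Set A)) ∧
      (∀ i, IsPartialIsoOn ar rel (F i : Set A) f) ∧
      ∀ y : Fin (ar E) → A, (∀ k, y k ∈ F k ∧ y k ≠ x) →
        ∃ σ : Equiv.Perm (Fin (ar E)), rel E (fun k => f (y (σ k)))

/-- The topology of pointwise convergence on a set `S` of self-maps of `X`,
where `X` carries the discrete topology. -/
def pointwiseTop (X : Type*) (S : Set (X → X)) : TopologicalSpace ↥S :=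
  TopologicalSpace.generateFrom
    {U : Set ↥S | ∃ x y : X, U = {f : ↥S | f.1 x = y}}

/-- Evaluation of the word `t₁ · s · t₂ · s ⋯ s · t_k` (with `t₁ = t`,
`[t₂, …, t_k] = ts` and multiplication being composition in diagrammatic
order) at `s`. -/
def polyEval {X : Type*} (t : X → X) (ts : List (X → X)) (s : X → X) : X → X :=
  ts.foldl (fun acc u => u ∘ s ∘ acc) t

/-- The Zariski topology on a set `S` of self-maps of `X` (a monoid under
composition in diagrammatic order). -/
def zariskiTop (X : Type*) (S : Set (X → X)) : TopologicalSpace ↥S :=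
  TopologicalSpace.generateFrom
    {U : Set ↥S | ∃ (t : ↥S) (ts : List ↥S) (u : ↥S) (us : List ↥S),
      U = {s : ↥S | polyEval t.1 (ts.map Subtype.val) s.1
              ≠ polyEval u.1 (us.map Subtype.val) s.1}}

section Helpers

variable {ar : ι → ℕ} {rel : ∀ i, (Fin (ar i) → A) → Prop}

theorem IsAuto.comp {f g : A → A} (hf : IsAuto ar rel f) (hg : IsAuto ar rel g) :
    IsAuto ar rel (f ∘ g) :=
  ⟨hf.1.comp hg.1, fun i x => (hg.2 i x).trans (hf.2 i (g ∘ x))⟩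

theorem IsAuto.exists_inverse {g : A → A} (hg : IsAuto ar rel g) :
    ∃ h : A → A, IsAuto ar rel h ∧ (∀ a, h (g a) = a) ∧ ∀ a, g (h a) = a := by
  obtain ⟨h, hl, hr⟩ := Function.bijective_iff_has_inverse.1 hg.1
  refine ⟨h, ⟨⟨hr.injective, hl.surjective⟩, fun i x => ?_⟩, hl, hr⟩
  rw [hg.2 i (h ∘ x), ← Function.comp_assoc, hr.comp_eq_id, Function.id_comp]

theorem isAuto_id : IsAuto ar rel (id : A → A) :=
  ⟨Function.bijective_id, fun _ _ => Iff.rfl⟩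

theorem IsAuto.isPartialIsoOn {g : A → A} (hg : IsAuto ar rel g) (D : Set A) :
    IsPartialIsoOn ar rel D g :=
  ⟨hg.1.injective.injOn, fun i x _ => hg.2 i x⟩

theorem IsPartialIsoOn.congr {D : Set A} {p q : A → A} (hp : IsPartialIsoOn ar rel D p)
    (h : Set.EqOn p q D) : IsPartialIsoOn ar rel D q := by
  refine ⟨hp.1.congr h, fun i x hx => ?_⟩
  have : q ∘ x = p ∘ x := funext fun k => (h (hx k)).symm
  rw [this]
  exact hp.2 i x hx

theorem IsPartialIsoOn.mono {D D' : Set A} {p : A → A} (hp : IsPartialIsoOn ar rel D p)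
    (h : D' ⊆ D) : IsPartialIsoOn ar rel D' p :=
  ⟨hp.1.mono h, fun i x hx => hp.2 i x fun k => h (hx k)⟩

theorem IsPartialIsoOn.comp {D D' : Set A} {p q : A → A} (hp : IsPartialIsoOn ar rel D' p)
    (hq : IsPartialIsoOn ar rel D q) (h : Set.MapsTo q D D') :
    IsPartialIsoOn ar rel D (p ∘ q) :=
  ⟨hp.1.comp hq.1 h, fun i x hx =>
    (hq.2 i x hx).trans (hp.2 i (q ∘ x) fun k => h (hx k))⟩

theorem IsPartialIsoOn.of_auto_comp {D : Set A} {g p q : A → A} (hg : IsAuto ar rel g)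
    (hq : IsPartialIsoOn ar rel D q) (h : ∀ a ∈ D, q a = g (p a)) :
    IsPartialIsoOn ar rel D p := by
  obtain ⟨g', hg', hl, -⟩ := hg.exists_inverse
  refine ((hg'.isPartialIsoOn Set.univ).comp hq (Set.mapsTo_univ _ _)).congr fun a ha => ?_
  simp [h a ha, hl]

theorem isEmb_of_forall_finset {p : A → A}
    (h : ∀ D : Finset A, IsPartialIsoOn ar rel (D : Set A) p) : IsEmb ar rel p := by
  classical
  refine ⟨fun a b hab => (h {a, b}).1 (by simp) (by simp) hab, fun i x => ?_⟩
  exact (h (Finset.univ.image x)).2 i x (by simp)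

theorem IsEmb.isPartialIsoOn {p : A → A} (h : IsEmb ar rel p) (D : Set A) :
    IsPartialIsoOn ar rel D p :=
  ⟨h.1.injOn, fun i x _ => h.2 i x⟩

theorem IsAuto.comp_isEmb {g p : A → A} (hg : IsAuto ar rel g) (hp : IsEmb ar rel p) :
    IsEmb ar rel (g ∘ p) :=
  ⟨hg.1.injective.comp hp.1, fun i x => (hp.2 i x).trans (hg.2 i (p ∘ x))⟩

/-- Along an ultrafilter, finite restrictions of a family of sequences lie in a single orbit. -/
theorem OmegaCategorical.exists_eventually_orbit (omcat : OmegaCategorical ar rel) {J : Type*}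
    (U : Ultrafilter J) (φ : J → ℕ → A) (k : ℕ) :
    ∃ j₀, ∀ᶠ j in (U : Filter J), ∃ g, IsAuto ar rel g ∧ ∀ m < k, φ j m = g (φ j₀ m) := by
  let o : (Fin k → A) → Set (Fin k → A) := fun v => {w | ∃ g, IsAuto ar rel g ∧ w = g ∘ v}
  let r : J → Fin k → A := fun j m => φ j m
  have hfin : (Set.range o).Finite := omcat k
  have hcover : (⋃ O ∈ Set.range o, {j | o (r j) = O}) ∈ U :=
    Filter.mem_of_superset Filter.univ_mem fun j _ => by simp
  obtain ⟨O, -, hO⟩ := (Ultrafilter.finite_biUnion_mem_iff hfin).1 hcover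
  obtain ⟨j₀, hj₀⟩ := U.nonempty_of_mem hO
  refine ⟨j₀, Filter.mem_of_superset hO fun j hj => ?_⟩
  have hmem : r j ∈ o (r j) := ⟨id, isAuto_id, rfl⟩
  rw [show o (r j) = o (r j₀) from Eq.trans hj (Eq.symm hj₀)] at hmem
  obtain ⟨g, hg, hgr⟩ := hmem
  exact ⟨g, hg, fun m hm => congrFun hgr ⟨m, hm⟩⟩

theorem OmegaCategorical.exists_limit_seq (omcat : OmegaCategorical ar rel) {J : Type*}
    (U : Ultrafilter J) (φ : J → ℕ → A) :
    ∃ e : ℕ → A, ∀ k, ∀ᶠ j in (U : Filter J),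
      ∃ g, IsAuto ar rel g ∧ ∀ m < k, φ j m = g (e m) := by
  let P : ℕ → (ℕ → A) → Prop := fun k w => ∀ᶠ j in (U : Filter J),
    ∃ g, IsAuto ar rel g ∧ ∀ m < k, φ j m = g (w m)
  have step : ∀ k w, P k w → ∃ w', P (k + 1) w' ∧ ∀ m < k, w' m = w m := by
    intro k w hw
    obtain ⟨j₀, hj₀⟩ := omcat.exists_eventually_orbit U φ (k + 1)
    obtain ⟨j₁, ⟨g₁, hg₁, h₁⟩, g₂, hg₂, h₂⟩ := (hw.and hj₀).exists
    obtain ⟨g₁', hg₁', hl₁, hr₁⟩ := hg₁.exists_inverse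
    obtain ⟨g₂', hg₂', hl₂, hr₂⟩ := hg₂.exists_inverse
    refine ⟨fun m => g₁' (φ j₁ m), ?_, fun m hm => ?_⟩
    · filter_upwards [hj₀] with j hj
      obtain ⟨g, hg, h⟩ := hj
      refine ⟨g ∘ g₂' ∘ g₁, hg.comp (hg₂'.comp hg₁), fun m hm => ?_⟩
      simp [hr₁, h₂ m hm, hl₂, h m hm]
    · simp [h₁ m hm, hl₁]
  obtain ⟨j⟩ := U.neBot.nonempty
  choose! next hnext hagree using step
  let w : ℕ → ℕ → A := fun k => Nat.rec (φ j) next k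
  have hw : ∀ k, P k (w k) := fun k => by
    induction k with
    | zero => exact Filter.Eventually.of_forall fun _ => ⟨id, isAuto_id, by simp⟩
    | succ k ih => exact hnext k _ ih
  have hstable : ∀ m k, m < k → w k m = w (m + 1) m := by
    intro m k hk
    induction k, hk using Nat.le_induction with
    | base => rfl
    | succ k hk ih => exact (hagree k _ (hw k) m hk).trans ih
  refine ⟨fun m => w (m + 1) m, fun k => ?_⟩
  filter_upwards [hw k] with j hj
  obtain ⟨g, hg, h⟩ := hj
  exact ⟨g, hg, fun m hm => by rw [h m hm, hstable m k hm]⟩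

/-- In an ω-categorical structure, a family of maps from a countable set has a limit along any
ultrafilter, modulo automorphisms. -/
theorem OmegaCategorical.exists_limit (omcat : OmegaCategorical ar rel) {J I : Type*}
    [Countable I] [Nonempty I] (U : Ultrafilter J) (φ : J → I → A) :
    ∃ e : I → A, ∀ T : Finset I, ∀ᶠ j in (U : Filter J),
      ∃ g, IsAuto ar rel g ∧ ∀ t ∈ T, φ j t = g (e t) := by
  obtain ⟨c, hc⟩ := exists_surjective_nat I
  obtain ⟨e, he⟩ := omcat.exists_limit_seq U fun j m => φ j (c m)
  refine ⟨fun i => e (Function.surjInv hc i), fun T => ?_⟩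
  filter_upwards [he (T.sup (Function.surjInv hc) + 1)] with j hj
  obtain ⟨g, hg, h⟩ := hj
  refine ⟨g, hg, fun t ht => ?_⟩
  have := h _ (Nat.lt_succ_of_le (Finset.le_sup (f := Function.surjInv hc) ht))
  rwa [Function.surjInv_eq hc] at this

/-- A version of `OmegaCategorical.exists_limit` for families indexed by finite sets. -/
theorem OmegaCategorical.exists_limit_finset (omcat : OmegaCategorical ar rel) {I : Type*}
    [Countable I] [Nonempty I] (φ : Finset A → I → A) :
    ∃ e : I → A, ∀ (T : Finset I) (D : Finset A), ∃ G, D ⊆ G ∧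
      ∃ g, IsAuto ar rel g ∧ ∀ t ∈ T, φ G t = g (e t) := by
  classical
  obtain ⟨e, he⟩ := omcat.exists_limit (Ultrafilter.of Filter.atTop) φ
  refine ⟨e, fun T D => ?_⟩
  have hD : ∀ᶠ G in (Ultrafilter.of (Filter.atTop : Filter (Finset A)) : Filter (Finset A)),
      D ⊆ G := Ultrafilter.of_le _ (Filter.eventually_ge_atTop D)
  obtain ⟨G, hG⟩ := (hD.and (he T)).exists
  exact ⟨G, hG⟩

/-- Without algebraicity, there are two embeddings which agree exactly off a given point. -/
theorem NoAlgebraicity.exists_emb_eq_iff_ne [Countable A] (noalg : NoAlgebraicity ar rel)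
    (omcat : OmegaCategorical ar rel) (a : A) :
    ∃ f g : A → A, IsEmb ar rel f ∧ IsEmb ar rel g ∧ ∀ b, f b = g b ↔ b ≠ a := by
  classical
  have hfin : ∀ G : Finset A, ∃ h, IsAuto ar rel h ∧ (∀ c ∈ G.erase a, h c = c) ∧ h a ≠ a := by
    intro G
    obtain ⟨b, ⟨h, hh, hfix, rfl⟩, hb⟩ :=
      (noalg (G.erase a) a (by simp)).exists_notMem_finite (Set.finite_singleton a)
    exact ⟨h, hh, hfix, hb⟩
  choose h hh hfix hne using hfin
  obtain ⟨e, he⟩ := omcat.exists_limit_finset (I := Option A)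
    fun G o => o.elim (h G a) id
  have hea : e (some a) ≠ e none := by
    obtain ⟨G, -, g, hg, heq⟩ := he {none, some a} ∅
    have h₁ := heq none (by simp)
    have h₂ := heq (some a) (by simp)
    intro hcontra
    rw [hcontra, ← h₁] at h₂
    exact hne G h₂.symm
  refine ⟨fun b => e (some b), fun b => if b = a then e none else e (some b),
    isEmb_of_forall_finset fun D => ?_, isEmb_of_forall_finset fun D => ?_, fun b => ?_⟩
  · obtain ⟨G, -, g, hg, heq⟩ := he (D.image some) ∅
    exact (isAuto_id.isPartialIsoOn _).of_auto_comp hg fun c hc =>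
      heq (some c) (Finset.mem_image_of_mem _ hc)
  · obtain ⟨G, hDG, g, hg, heq⟩ := he (insert none (D.image some)) D
    refine ((hh G).isPartialIsoOn _).of_auto_comp hg fun c hc => ?_
    by_cases hca : c = a
    · subst hca
      simpa using heq none (by simp)
    · rw [hfix G c (Finset.mem_erase.2 ⟨hca, hDG hc⟩), if_neg hca]
      exact heq (some c) (Finset.mem_insert_of_mem (Finset.mem_image_of_mem _ hc))
  · by_cases hb : b = a
    · subst hb
      simpa using hea
    · simp [hb]

/-- Without algebraicity, a finite set can be moved away from another one while fixing
finitely many points outside the former. -/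
theorem NoAlgebraicity.exists_auto_disjoint (noalg : NoAlgebraicity ar rel) (F H G : Finset A)
    (hGF : ∀ a ∈ G, a ∉ F) :
    ∃ h, IsAuto ar rel h ∧ (∀ a ∈ F, h a = a) ∧ ∀ a ∈ G, h a ∉ H := by
  classical
  induction G using Finset.induction_on with
  | empty => exact ⟨id, isAuto_id, by simp, by simp⟩
  | insert a G ha ih =>
    obtain ⟨h, hh, hF, hG⟩ := ih fun b hb => hGF b (Finset.mem_insert_of_mem hb)
    have hnot : h a ∉ F ∪ G.image h := by
      simp only [Finset.mem_union, Finset.mem_image, not_or, not_exists, not_and]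
      refine ⟨fun hmem => ?_, fun b hb hba => ha (hh.1.injective hba ▸ hb)⟩
      exact hGF a (Finset.mem_insert_self _ _) (hh.1.injective (hF _ hmem) ▸ hmem)
    obtain ⟨b, ⟨k, hk, hfix, rfl⟩, hb⟩ := (noalg _ _ hnot).exists_notMem_finset H
    refine ⟨k ∘ h, hk.comp hh, fun c hc => ?_, fun c hc => ?_⟩
    · simp [hF c hc, hfix c (Finset.mem_union_left _ hc)]
    · rcases Finset.mem_insert.1 hc with rfl | hc
      · exact hb
      · simpa [hfix (h c) (Finset.mem_union_right _ (Finset.mem_image_of_mem _ hc))]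
          using hG c hc

/-- Without algebraicity, a finite set has infinitely many copies which pairwise meet only
in a given point. -/
theorem NoAlgebraicity.exists_seq_auto (noalg : NoAlgebraicity ar rel) (x : A) (G : Finset A) :
    ∃ h : ℕ → A → A, (∀ m, IsAuto ar rel (h m) ∧ h m x = x) ∧
      ∀ m n, m ≠ n → ∀ a ∈ G, ∀ b ∈ G, h m a = h n b → h m a = x := by
  classical
  obtain ⟨h, hh, hd⟩ := exists_seq_of_forall_finset_exists
    (fun h : A → A => IsAuto ar rel h ∧ h x = x)
    (fun h k => ∀ a ∈ G, ∀ b ∈ G, h a = k b → h a = x) (fun s hs => by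
      obtain ⟨k, hk, hkx, hkd⟩ := noalg.exists_auto_disjoint {x}
        (s.biUnion fun h => G.image h) (G.erase x) (by simp +contextual)
      have hkx : k x = x := hkx x (by simp)
      refine ⟨k, ⟨hk, hkx⟩, fun h hhs a ha b hb hab => ?_⟩
      by_cases hbx : b = x
      · rw [hab, hbx, hkx]
      · refine absurd ?_ (hkd b (Finset.mem_erase.2 ⟨hbx, hb⟩))
        exact Finset.mem_biUnion.2 ⟨h, hhs, Finset.mem_image.2 ⟨a, ha, hab⟩⟩)
  refine ⟨h, hh, fun m n hmn a ha b hb hab => ?_⟩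
  rcases lt_or_gt_of_ne hmn with hlt | hlt
  · exact hd m n hlt a ha b hb hab
  · exact hab.trans (hd n m hlt b hb a ha hab.symm)

/-- Finite approximations of the embeddings in `ArsfacereWith.exists_emb`. -/
theorem ArsfacereWith.exists_partialIso {E : ι} (ars : ArsfacereWith ar rel E)
    (noalg : NoAlgebraicity ar rel) (x : A) (G : Finset A) :
    ∃ e : Fin (ar E) × A → A,
      (∀ i, IsPartialIsoOn ar rel (G : Set A) fun a => e (i, a)) ∧
      (∀ i j, e (i, x) = e (j, x)) ∧
      ∀ y : Fin (ar E) → A, (∀ k, y k ∈ G ∧ y k ≠ x) →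
        ∃ σ : Equiv.Perm (Fin (ar E)), rel E fun k => e (σ k, y (σ k)) := by
  classical
  obtain ⟨h, hh, hd⟩ := noalg.exists_seq_auto x (insert x G)
  obtain ⟨f, -, hiso, hrel⟩ := ars.2 x (fun i => (insert x G).image (h i)) (by
    intro i j hij
    ext z
    constructor
    · rintro ⟨hi, hj⟩
      obtain ⟨a, ha, rfl⟩ := Finset.mem_image.1 (Finset.mem_coe.1 hi)
      obtain ⟨b, hb, hab⟩ := Finset.mem_image.1 (Finset.mem_coe.1 hj)
      exact hd i j (fun hc => hij (Fin.ext hc)) a ha b hb hab.symm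
    · rintro rfl
      exact ⟨Finset.mem_coe.2 (Finset.mem_image.2 ⟨z, by simp, (hh i).2⟩),
        Finset.mem_coe.2 (Finset.mem_image.2 ⟨z, by simp, (hh j).2⟩)⟩)
  refine ⟨fun p => f (h p.1 p.2), fun i => ?_, fun i j => ?_, fun y hy => ?_⟩
  · exact (hiso i).comp ((hh i).1.isPartialIsoOn _) fun a ha =>
      Finset.mem_coe.2 (Finset.mem_image_of_mem _ (Finset.mem_insert_of_mem ha))
  · simp only [(hh i).2, (hh j).2]
  · exact hrel (fun k => h k (y k)) fun k =>
      ⟨Finset.mem_image_of_mem _ (Finset.mem_insert_of_mem (hy k).1), fun hk =>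
        (hy k).2 ((hh k).1.1.injective (hk.trans (hh k).2.symm))⟩

/-- In an arsfacere structure, there are embeddings fixing `x` such that all tuples of points
different from `x` in their respective images are `E`-related up to permutation. -/
theorem ArsfacereWith.exists_emb [Countable A] {E : ι} (ars : ArsfacereWith ar rel E)
    (homog : Homogeneous ar rel) (omcat : OmegaCategorical ar rel)
    (noalg : NoAlgebraicity ar rel) (x : A) :
    ∃ e : Fin (ar E) → A → A, (∀ i, IsEmb ar rel (e i)) ∧ (∀ i, e i x = x) ∧
      ∀ y : Fin (ar E) → A, (∀ k, y k ≠ x) →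
        ∃ σ : Equiv.Perm (Fin (ar E)), rel E fun k => e (σ k) (y (σ k)) := by
  classical
  choose φ hiso hx hrel using ars.exists_partialIso noalg x
  rcases isEmpty_or_nonempty (Fin (ar E)) with hE | ⟨⟨i₀⟩⟩
  · obtain ⟨σ, hσ⟩ := hrel ∅ isEmptyElim isEmptyElim
    exact absurd (by convert hσ) (ars.1 x)
  have : Nonempty (Fin (ar E) × A) := ⟨(i₀, x)⟩
  obtain ⟨e, he⟩ := omcat.exists_limit_finset φ
  have hemb : ∀ i, IsEmb ar rel fun a => e (i, a) := fun i => isEmb_of_forall_finset fun D => by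
    obtain ⟨G, hDG, g, hg, heq⟩ := he (D.image fun a => (i, a)) D
    exact ((hiso G i).mono (Finset.coe_subset.2 hDG)).of_auto_comp hg fun a ha =>
      heq (i, a) (Finset.mem_image_of_mem _ ha)
  have hex : ∀ i, e (i, x) = e (i₀, x) := fun i => by
    obtain ⟨G, -, g, hg, heq⟩ := he {(i, x), (i₀, x)} ∅
    apply hg.1.injective
    rw [← heq _ (by simp), ← heq _ (by simp), hx G i i₀]
  obtain ⟨g, hg, hgx⟩ := homog {x} _ ((hemb i₀).isPartialIsoOn _)
  obtain ⟨g', hg', hl, hr⟩ := hg.exists_inverse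
  refine ⟨fun i a => g' (e (i, a)), fun i => hg'.comp_isEmb (hemb i), fun i => ?_,
    fun y hy => ?_⟩
  · simp only [hex i, ← hgx x (by simp), hl]
  · obtain ⟨G, hDG, k, hk, heq⟩ := he (Finset.univ.image fun i => (i, y i)) (Finset.univ.image y)
    obtain ⟨σ, hσ⟩ := hrel G y fun i => ⟨hDG (by simp), hy i⟩
    refine ⟨σ, (hg'.2 E fun i => e (σ i, y (σ i))).1 ((hk.2 E _).2 ?_)⟩
    convert hσ using 2 with i
    exact (heq _ (by simp)).symm

end Helpers

section ZariskiTopology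

open scoped Topology

theorem isOpen_pointwiseTop_polyEval_eq {S : Set (A → A)} (t : A → A) (ts : List (A → A))
    (a b : A) : IsOpen[pointwiseTop A S] {s : S | polyEval t ts s.1 a = b} := by
  let _ := pointwiseTop A S
  suffices H : ∀ (acc : S → A → A), (∀ a b, IsOpen {s : S | acc s a = b}) →
      ∀ a b, IsOpen {s : S | polyEval (acc s) ts s.1 a = b} from
    H (fun _ => t) (fun _ _ => isOpen_const) a b
  induction ts with
  | nil => exact fun acc h => h
  | cons u us ih =>
    refine fun acc h => ih (fun s => u ∘ s.1 ∘ acc s) fun a b => ?_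
    have : {s : S | (u ∘ s.1 ∘ acc s) a = b} =
        ⋃ c, ⋃ d, ⋃ (_ : u d = b), {s : S | acc s a = c} ∩ {s : S | s.1 c = d} := by
      ext s
      simp
    rw [this]
    exact isOpen_iUnion fun c => isOpen_iUnion fun d => isOpen_iUnion fun _ =>
      (h a c).inter (TopologicalSpace.isOpen_generateFrom_of_mem ⟨c, d, rfl⟩)

theorem pointwiseTop_le_zariskiTop (S : Set (A → A)) : pointwiseTop A S ≤ zariskiTop A S := by
  let _ := pointwiseTop A S
  refine le_generateFrom ?_
  rintro _ ⟨t, ts, u, us, rfl⟩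
  have : {s : S | polyEval t.1 (ts.map Subtype.val) s.1 ≠ polyEval u.1 (us.map Subtype.val) s.1} =
      ⋃ a, ⋃ b, ⋃ c, ⋃ (_ : b ≠ c), {s : S | polyEval t.1 (ts.map Subtype.val) s.1 a = b} ∩
        {s : S | polyEval u.1 (us.map Subtype.val) s.1 a = c} := by
    ext s
    simp [Function.ne_iff, eq_comm]
  rw [this]
  exact isOpen_iUnion fun a => isOpen_iUnion fun b => isOpen_iUnion fun c => isOpen_iUnion fun _ =>
    (isOpen_pointwiseTop_polyEval_eq _ _ a b).inter (isOpen_pointwiseTop_polyEval_eq _ _ a c)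

theorem isOpen_zariskiTop_mem_range_comp {S : Set (A → A)} {f g e : A → A} (hf : f ∈ S)
    (hg : g ∈ S) (he : e ∈ S) {y : A} (hfg : ∀ b, f b = g b ↔ b ≠ y) :
    IsOpen[zariskiTop A S] {s : S | ∃ a, s.1 (e a) = y} := by
  refine TopologicalSpace.isOpen_generateFrom_of_mem
    ⟨⟨e, he⟩, [⟨f, hf⟩], ⟨e, he⟩, [⟨g, hg⟩], ?_⟩
  ext s
  simp [polyEval, Function.ne_iff, hfg]

end ZariskiTopology

theorem zariski_eq_pointwise_arsfacere
    [Countable A]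
    (ar : ι → ℕ) (rel : ∀ i, (Fin (ar i) → A) → Prop)
    (homog : Homogeneous ar rel)
    (omcat : OmegaCategorical ar rel)
    (noalg : NoAlgebraicity ar rel)
    (ars : ∃ E : ι, ArsfacereWith ar rel E)
    (S : Set (A → A))
    (hembS : embSet ar rel ⊆ S)
    (hSend : S ⊆ endSet ar rel)
    (hcomp : ∀ f ∈ S, ∀ g ∈ S, g ∘ f ∈ S) :
    zariskiTop A S = pointwiseTop A S := by
  obtain ⟨E, ars⟩ := ars
  refine le_antisymm (le_generateFrom ?_) (pointwiseTop_le_zariskiTop S)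
  rintro _ ⟨x, y, rfl⟩
  obtain ⟨e, hemb, hex, hrel⟩ := ars.exists_emb homog omcat noalg x
  obtain ⟨f, g, hf, hg, hfg⟩ := noalg.exists_emb_eq_iff_ne omcat y
  have hset : {s : S | s.1 x = y} = ⋂ i, {s : S | ∃ a, s.1 (e i a) = y} := by
    ext s
    simp only [Set.mem_ofPred_eq, Set.mem_iInter]
    refine ⟨fun hs i => ⟨x, by rw [hex, hs]⟩, fun hs => ?_⟩
    choose u hu using hs
    by_cases hux : ∀ i, u i ≠ x
    · obtain ⟨σ, hσ⟩ := hrel u hux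
      refine absurd (hSend s.2 E _ hσ) ?_
      convert ars.1 y using 2
      exact funext fun k => hu (σ k)
    · push Not at hux
      obtain ⟨i, hi⟩ := hux
      rw [← hu i, hi, hex]
  rw [hset]
  let _ := zariskiTop A S
  exact isOpen_iInter_of_finite fun i =>
    isOpen_zariskiTop_mem_range_comp (hembS hf) (hembS hg) (hembS (hemb i)) hfg
end

section
/- Let R be the random graph. Then the pointwise topology on End(R) is a Polish semigroup topology, and it is the unique Polish semigroup topology on End(R): every Polish topology on End(R) making composition continuous equals the pointwise topology. -/
variable {G : Type*}

/-- The extension property characterising the random graph: for all disjoint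
finite sets `U`, `V` of vertices there is a vertex outside `U ∪ V` adjacent to
everything in `U` and to nothing in `V`. -/
def ExtensionProperty (adj : G → G → Prop) : Prop :=
  ∀ U V : Finset G, (∀ x ∈ U, x ∉ V) →
    ∃ w : G, w ∉ U ∧ w ∉ V ∧ (∀ u ∈ U, adj w u) ∧ (∀ v ∈ V, ¬ adj w v)

/-- The endomorphism monoid of the graph `(G, adj)`, as a set of functions. -/
def graphEnd (adj : G → G → Prop) : Set (G → G) :=
  {f : G → G | ∀ x y : G, adj x y → adj (f x) (f y)}

theorem graphEnd_comp (adj : G → G → Prop) :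
    ∀ f ∈ graphEnd adj, ∀ g ∈ graphEnd adj, g ∘ f ∈ graphEnd adj :=
  fun _ hf _ hg x y h => hg _ _ (hf x y h)

/-- `τ` is a Polish semigroup topology on the set `S` of self-maps of `X`
(a semigroup under composition in diagrammatic order, `hS` witnessing closure
under composition): `τ` is Polish and composition is continuous. -/
def IsPolishSemigroupTop {X : Type*} {S : Set (X → X)}
    (hS : ∀ f ∈ S, ∀ g ∈ S, g ∘ f ∈ S) (τ : TopologicalSpace ↥S) : Prop :=
  @PolishSpace ↥S τ ∧
    @Continuous (↥S × ↥S) ↥S (@instTopologicalSpaceProd ↥S ↥S τ τ) τ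
      (fun p => ⟨p.2.1 ∘ p.1.1, hS p.1.1 p.1.2 p.2.1 p.2.2⟩)

theorem exists_monotone_seq_meeting {α ι : Type*} [Countable ι] (P : Finset α → Prop)
    (T : ι → Finset α → Prop) (hT : ∀ i p, P p → ∃ q, p ⊆ q ∧ P q ∧ T i q)
    (p₀ : Finset α) (h₀ : P p₀) :
    ∃ s : ℕ → Finset α, Monotone s ∧ s 0 = p₀ ∧ (∀ n, P (s n)) ∧ ∀ i, ∃ n, T i (s n) := by
  obtain ⟨_⟩ := nonempty_encodable ι
  let D : ι → Order.Cofinal {p : Finset α // P p} := fun i =>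
    { carrier := {p | T i p.1}
      isCofinal := fun p => by
        obtain ⟨q, hpq, hq, hTq⟩ := hT i p.1 p.2
        exact ⟨⟨q, hq⟩, hTq, hpq⟩ }
  refine ⟨fun n => (Order.sequenceOfCofinals ⟨p₀, h₀⟩ D n).1,
    fun m n h => Order.sequenceOfCofinals.monotone ⟨p₀, h₀⟩ D h, rfl,
    fun n => (Order.sequenceOfCofinals ⟨p₀, h₀⟩ D n).2,
    fun i => ⟨Encodable.encode i + 1, ?_⟩⟩
  have h : Order.sequenceOfCofinals (⟨p₀, h₀⟩ : {p // P p}) D (Encodable.encode i + 1) ∈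
    (D i).carrier := Order.sequenceOfCofinals.encode_mem _ D i
  exact h

theorem ExtensionProperty.exists_adj_iff {adj : G → G → Prop} (hext : ExtensionProperty adj)
    (W : Finset G) (P : G → Prop) : ∃ w, ∀ v ∈ W, w ≠ v ∧ (adj w v ↔ P v) := by
  classical
  obtain ⟨w, h1, h2, h3, h4⟩ := hext (W.filter P) (W.filter fun v => ¬ P v) (by
    intro x hx hx'
    simp only [Finset.mem_filter] at hx hx'
    exact hx'.2 hx.2)
  refine ⟨w, fun v hv => ?_⟩
  simp only [Finset.mem_filter] at h1 h2 h3 h4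
  by_cases hP : P v
  · exact ⟨fun h => h1 (h ▸ ⟨hv, hP⟩), fun _ => hP, fun _ => h3 v ⟨hv, hP⟩⟩
  · exact ⟨fun h => h2 (h ▸ ⟨hv, hP⟩), fun h => absurd h (h4 v ⟨hv, hP⟩), fun h => absurd h hP⟩

/-- There is an endomorphism of the random graph whose fibres are generic: every admissible
one-point extension problem over a finite set can be solved inside the prescribed fibre. -/
theorem ExtensionProperty.exists_generic_end [Countable G] {adj : G → G → Prop}
    (hsymm : ∀ ⦃x y⦄, adj x y → adj y x) (hirr : ∀ x, ¬ adj x x) (hext : ExtensionProperty adj) :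
    ∃ f ∈ graphEnd adj, ∀ (W : Finset G) (P : G → Prop) (v : G),
      (∀ u ∈ W, P u → adj v (f u)) → ∃ w, f w = v ∧ ∀ u ∈ W, w ≠ u ∧ (adj w u ↔ P u) := by
  classical
  let Q : Finset (G × G) → Prop := fun p => ∀ q ∈ p, ∀ q' ∈ p,
    (q.1 = q'.1 → q.2 = q'.2) ∧ (adj q.1 q'.1 → adj q.2 q'.2)
  let T : G ⊕ (Finset G × Finset G × G) → Finset (G × G) → Prop := fun i p =>
    match i with
    | .inl a => ∃ b, (a, b) ∈ p
    | .inr (U, W, v) => (∃ q ∈ p, q.1 ∈ U ∧ ¬ adj v q.2) ∨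
        ∃ w, (w, v) ∈ p ∧ ∀ u ∈ W, w ≠ u ∧ (adj w u ↔ u ∈ U)
  have dom : ∀ a p, Q p → ∃ q, p ⊆ q ∧ Q q ∧ ∃ b, (a, b) ∈ q := by
    intro a p hp
    by_cases ha : ∃ b, (a, b) ∈ p
    · exact ⟨p, subset_rfl, hp, ha⟩
    obtain ⟨b, hb⟩ := hext.exists_adj_iff (p.image Prod.snd) (fun _ => True)
    refine ⟨insert (a, b) p, Finset.subset_insert _ _, ?_, b, Finset.mem_insert_self _ _⟩
    have hb' : ∀ q ∈ p, adj b q.2 := fun q hq =>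
      (hb q.2 (Finset.mem_image_of_mem _ hq)).2.2 trivial
    intro q hq q' hq'
    rcases Finset.mem_insert.1 hq with rfl | hq <;> rcases Finset.mem_insert.1 hq' with rfl | hq'
    · exact ⟨fun _ => rfl, fun h => absurd h (hirr _)⟩
    · exact ⟨fun h => absurd ⟨q'.2, by rw [show a = q'.1 from h]; exact hq'⟩ ha, fun _ => hb' q' hq'⟩
    · exact ⟨fun h => absurd ⟨q.2, by rw [← show q.1 = a from h]; exact hq⟩ ha,
        fun _ => hsymm (hb' q hq)⟩
    · exact hp q hq q' hq'
  have hT : ∀ i p, Q p → ∃ q, p ⊆ q ∧ Q q ∧ T i q := by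
    rintro (a | ⟨U, W, v⟩) p hp
    · exact dom a p hp
    by_cases hU : ∃ q ∈ p, q.1 ∈ U ∧ ¬ adj v q.2
    · exact ⟨p, subset_rfl, hp, Or.inl hU⟩
    push Not at hU
    obtain ⟨w, hw⟩ := hext.exists_adj_iff (p.image Prod.fst ∪ W) (fun u => u ∈ U)
    have hw' : ∀ q ∈ p, w ≠ q.1 ∧ (adj w q.1 ↔ q.1 ∈ U) := fun q hq =>
      hw q.1 (Finset.mem_union_left _ (Finset.mem_image_of_mem _ hq))
    refine ⟨insert (w, v) p, Finset.subset_insert _ _, ?_,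
      Or.inr ⟨w, Finset.mem_insert_self _ _, fun u hu => hw u (Finset.mem_union_right _ hu)⟩⟩
    intro q hq q' hq'
    rcases Finset.mem_insert.1 hq with rfl | hq <;> rcases Finset.mem_insert.1 hq' with rfl | hq'
    · exact ⟨fun _ => rfl, fun h => absurd h (hirr _)⟩
    · exact ⟨fun h => absurd h (hw' q' hq').1, fun h => hU q' hq' ((hw' q' hq').2.1 h)⟩
    · exact ⟨fun h => absurd h.symm (hw' q hq).1,
        fun h => hsymm (hU q hq ((hw' q hq).2.1 (hsymm h)))⟩
    · exact hp q hq q' hq'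
  obtain ⟨s, hs, -, hQ, hTs⟩ := exists_monotone_seq_meeting Q T hT ∅ (by simp [Q])
  have pair : ∀ m n, ∀ q ∈ s m, ∀ q' ∈ s n,
      (q.1 = q'.1 → q.2 = q'.2) ∧ (adj q.1 q'.1 → adj q.2 q'.2) := fun m n q hq q' hq' =>
    hQ (max m n) q (hs (le_max_left _ _) hq) q' (hs (le_max_right _ _) hq')
  choose N f hf using fun a => hTs (.inl a)
  refine ⟨f, fun x y h => (pair _ _ _ (hf x) _ (hf y)).2 h, fun W P v hv => ?_⟩
  obtain ⟨n, hn⟩ := hTs (.inr (W.filter P, W, v))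
  rcases hn with ⟨q, hq, hqU, hnot⟩ | ⟨w, hw, hW⟩
  · rw [Finset.mem_filter] at hqU
    have := (pair _ _ _ (hf q.1) q hq).1 rfl
    exact absurd (this ▸ hv _ hqU.1 hqU.2) hnot
  · refine ⟨w, (pair _ _ _ (hf w) _ hw).1 rfl, fun u hu => ?_⟩
    have := hW u hu
    simpa [hu] using this

/-- There is a self-embedding of the random graph such that every admissible finite one-point
extension problem has a solution outside the range, with only finitely many, controlled,
neighbours in the range. -/
theorem ExtensionProperty.exists_sparse_embedding [Countable G] {adj : G → G → Prop}
    (hsymm : ∀ ⦃x y⦄, adj x y → adj y x) (hirr : ∀ x, ¬ adj x x) (hext : ExtensionProperty adj) :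
    ∃ g : G → G, Function.Injective g ∧ (∀ x y, adj (g x) (g y) ↔ adj x y) ∧
      (∀ u, u ∉ Set.range g → {x | adj u (g x)}.Finite) ∧
      ∀ (W : Finset G) (P : G → Prop), ∃ u, u ∉ Set.range g ∧
        (∀ v ∈ W, u ≠ v ∧ (adj u v ↔ P v)) ∧ ∀ x, adj u (g x) → g x ∈ W := by
  classical
  let Q : Finset ((G × G) ⊕ (G × Finset G)) → Prop := fun p =>
    (∀ q q', .inl q ∈ p → .inl q' ∈ p → (q.1 = q'.1 ↔ q.2 = q'.2) ∧ (adj q.1 q'.1 ↔ adj q.2 q'.2)) ∧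
    ∀ q e, .inl q ∈ p → .inr e ∈ p → q.2 ≠ e.1 ∧ (adj e.1 q.2 → q.2 ∈ e.2)
  let T : G ⊕ (G ⊕ (Finset G × Finset G)) → Finset ((G × G) ⊕ (G × Finset G)) → Prop := fun i p =>
    match i with
    | .inl a => ∃ b, .inl (a, b) ∈ p
    | .inr (.inl u) => (∃ a, .inl (a, u) ∈ p) ∨ ∃ N, .inr (u, N) ∈ p
    | .inr (.inr (U, W)) => ∃ u, .inr (u, U) ∈ p ∧ ∀ v ∈ W, u ≠ v ∧ (adj u v ↔ v ∈ U)
  have add : ∀ p u N, Q p → (∀ q, .inl q ∈ p → q.2 ≠ u ∧ (adj u q.2 → q.2 ∈ N)) →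
      Q (insert (.inr (u, N)) p) := by
    intro p u N hp h
    refine ⟨fun q q' hq hq' => hp.1 q q' (by simpa using hq) (by simpa using hq'),
      fun q e hq he => ?_⟩
    have hq : .inl q ∈ p := by simpa using hq
    rcases Finset.mem_insert.1 he with he | he
    · cases he
      exact h q hq
    · exact hp.2 q e hq he
  have hT : ∀ i p, Q p → ∃ q, p ⊆ q ∧ Q q ∧ T i q := by
    intro i p hp
    let rg : Finset G := p.biUnion (fun z => Sum.elim (fun q => {q.2}) (fun _ => ∅) z)
    let ex : Finset G := p.biUnion (fun z => Sum.elim (fun _ => ∅) (fun e => {e.1}) z)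
    have hrg : ∀ q, .inl q ∈ p → q.2 ∈ rg := fun q hq =>
      Finset.mem_biUnion.2 ⟨_, hq, by simp⟩
    have hex : ∀ e, .inr e ∈ p → e.1 ∈ ex := fun q hq =>
      Finset.mem_biUnion.2 ⟨_, hq, by simp⟩
    rcases i with a | u | ⟨U, W⟩
    · by_cases ha : ∃ b, .inl (a, b) ∈ p
      · exact ⟨p, subset_rfl, hp, ha⟩
      obtain ⟨b, hb⟩ := hext.exists_adj_iff (rg ∪ ex) (fun v => ∃ c, .inl (c, v) ∈ p ∧ adj a c)
      have h1 : ∀ q, .inl q ∈ p → (a = q.1 ↔ b = q.2) ∧ (adj a q.1 ↔ adj b q.2) := by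
        intro q hq
        have := hb q.2 (Finset.mem_union_left _ (hrg q hq))
        refine ⟨⟨fun h => absurd ⟨q.2, by rw [h]; exact hq⟩ ha, fun h => absurd h this.1⟩, ?_⟩
        rw [this.2]
        refine ⟨fun h => ⟨q.1, hq, h⟩, fun ⟨c, hc, hac⟩ => ?_⟩
        rwa [← ((hp.1 _ _ hc hq).1.2 rfl)]
      refine ⟨insert (.inl (a, b)) p, Finset.subset_insert _ _, ⟨?_, ?_⟩, b,
        Finset.mem_insert_self _ _⟩
      · intro q q' hq hq'
        rcases Finset.mem_insert.1 hq with hq | hq <;> rcases Finset.mem_insert.1 hq' with hq' | hq'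
        · cases hq; cases hq'
          simp [hirr a, hirr b]
        · cases hq
          exact h1 q' hq'
        · cases hq'
          have := h1 q hq
          exact ⟨by rw [eq_comm, this.1, eq_comm], fun h => hsymm (this.2.1 (hsymm h)),
            fun h => hsymm (this.2.2 (hsymm h))⟩
        · exact hp.1 q q' hq hq'
      · intro q e hq he
        have he : .inr e ∈ p := by simpa using he
        rcases Finset.mem_insert.1 hq with hq | hq
        · cases hq
          have := hb e.1 (Finset.mem_union_right _ (hex e he))
          refine ⟨this.1, fun h => ?_⟩
          obtain ⟨c, hc, -⟩ := this.2.1 (hsymm h)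
          exact absurd rfl (hp.2 _ _ hc he).1
        · exact hp.2 q e hq he
    · by_cases hu : ∃ a, .inl (a, u) ∈ p
      · exact ⟨p, subset_rfl, hp, Or.inl hu⟩
      · refine ⟨insert (.inr (u, rg)) p, Finset.subset_insert _ _, add p u rg hp ?_,
          Or.inr ⟨rg, Finset.mem_insert_self _ _⟩⟩
        rintro q hq
        exact ⟨fun h => hu ⟨q.1, by rw [← h]; exact hq⟩, fun _ => hrg q hq⟩
    · obtain ⟨u, hu⟩ := hext.exists_adj_iff (rg ∪ W) (fun v => v ∈ U)
      refine ⟨insert (.inr (u, U)) p, Finset.subset_insert _ _, add p u U hp fun q hq => ?_,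
        u, Finset.mem_insert_self _ _, fun v hv => hu v (Finset.mem_union_right _ hv)⟩
      have := hu q.2 (Finset.mem_union_left _ (hrg q hq))
      exact ⟨this.1.symm, this.2.1⟩
  obtain ⟨s, hs, -, hQ, hTs⟩ := exists_monotone_seq_meeting Q T hT ∅ (by simp [Q])
  have pair : ∀ m n q q', .inl q ∈ s m → .inl q' ∈ s n →
      (q.1 = q'.1 ↔ q.2 = q'.2) ∧ (adj q.1 q'.1 ↔ adj q.2 q'.2) := fun m n q q' hq hq' =>
    (hQ (max m n)).1 q q' (hs (le_max_left _ _) hq) (hs (le_max_right _ _) hq')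
  have out : ∀ m n q e, .inl q ∈ s m → .inr e ∈ s n →
      q.2 ≠ e.1 ∧ (adj e.1 q.2 → q.2 ∈ e.2) := fun m n q q' hq hq' =>
    (hQ (max m n)).2 q q' (hs (le_max_left _ _) hq) (hs (le_max_right _ _) hq')
  choose N g hg using fun a => hTs (.inl a)
  have hinj : Function.Injective g := fun x y h => (pair _ _ _ _ (hg x) (hg y)).1.2 h
  refine ⟨g, hinj, fun x y => (pair _ _ _ _ (hg x) (hg y)).2.symm, fun u hu => ?_, fun W P => ?_⟩
  · obtain ⟨n, ⟨a, ha⟩ | ⟨M, hM⟩⟩ := hTs (.inr (.inl u))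
    · exact absurd ⟨a, (pair _ _ _ _ (hg a) ha).1.1 rfl⟩ hu
    · exact (M.finite_toSet.preimage hinj.injOn).subset fun x hx => (out _ _ _ _ (hg x) hM).2 hx
  · obtain ⟨n, u, hu, hW⟩ := hTs (.inr (.inr (W.filter P, W)))
    refine ⟨u, ?_, fun v hv => ?_, fun x hx => ?_⟩
    · rintro ⟨x, hx⟩
      exact (out _ _ _ _ (hg x) hu).1 hx
    · have := hW v hv
      simpa [hv] using this
    · exact (Finset.mem_filter.1 ((out _ _ _ _ (hg x) hu).2 hx)).1

/-- Back-and-forth: with `f` generic and `g` sparse, a finite partial automorphism compatible with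
the endomorphism `s` extends to an automorphism `t` with `f ∘ t ∘ g = s`. -/
theorem exists_automorphism_factorization [Countable G] {adj : G → G → Prop}
    (hsymm : ∀ ⦃x y⦄, adj x y → adj y x) (hirr : ∀ x, ¬ adj x x) (hext : ExtensionProperty adj)
    {f g s : G → G} (hs : s ∈ graphEnd adj)
    (hf : ∀ (W : Finset G) (P : G → Prop) (v : G),
      (∀ u ∈ W, P u → adj v (f u)) → ∃ w, f w = v ∧ ∀ u ∈ W, w ≠ u ∧ (adj w u ↔ P u))
    (hginj : Function.Injective g) (hgadj : ∀ x y, adj (g x) (g y) ↔ adj x y)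
    (hgfin : ∀ u, u ∉ Set.range g → {x | adj u (g x)}.Finite)
    (hgext : ∀ (W : Finset G) (P : G → Prop), ∃ u, u ∉ Set.range g ∧
      (∀ v ∈ W, u ≠ v ∧ (adj u v ↔ P v)) ∧ ∀ x, adj u (g x) → g x ∈ W)
    (p₀ : Finset (G × G))
    (hiso : ∀ q ∈ p₀, ∀ q' ∈ p₀, (q.1 = q'.1 ↔ q.2 = q'.2) ∧ (adj q.1 q'.1 ↔ adj q.2 q'.2))
    (hcl : ∀ q ∈ p₀, q.1 ∉ Set.range g → ∀ x, adj q.1 (g x) → ∃ b, (g x, b) ∈ p₀)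
    (hval : ∀ x b, (g x, b) ∈ p₀ → f b = s x) :
    ∃ t : G ≃ G, (∀ x y, adj (t x) (t y) ↔ adj x y) ∧ (∀ x, f (t (g x)) = s x) ∧
      ∀ q ∈ p₀, t q.1 = q.2 := by
  classical
  let Q : Finset (G × G) → Prop := fun p =>
    (∀ q ∈ p, ∀ q' ∈ p, (q.1 = q'.1 ↔ q.2 = q'.2) ∧ (adj q.1 q'.1 ↔ adj q.2 q'.2)) ∧
    (∀ q ∈ p, q.1 ∉ Set.range g → ∀ x, adj q.1 (g x) → ∃ b, (g x, b) ∈ p) ∧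
    (∀ x b, (g x, b) ∈ p → f b = s x)
  have add : ∀ p a b, Q p → (∀ q ∈ p, a ≠ q.1 ∧ b ≠ q.2 ∧ (adj a q.1 ↔ adj b q.2)) →
      (a ∉ Set.range g → ∀ x, adj a (g x) → ∃ c, (g x, c) ∈ p) → (∀ x, g x = a → f b = s x) →
      Q (insert (a, b) p) := by
    intro p a b hp h1 h2 h3
    refine ⟨fun q hq q' hq' => ?_, fun q hq hqr x hx => ?_, fun x c hx => ?_⟩
    · rcases Finset.mem_insert.1 hq with rfl | hq <;> rcases Finset.mem_insert.1 hq' with rfl | hq'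
      · simp [hirr a, hirr b]
      · have := h1 q' hq'
        exact ⟨⟨fun h => absurd h this.1, fun h => absurd h this.2.1⟩, this.2.2⟩
      · have := h1 q hq
        exact ⟨⟨fun h => absurd h.symm this.1, fun h => absurd h.symm this.2.1⟩,
          fun h => hsymm (this.2.2.1 (hsymm h)), fun h => hsymm (this.2.2.2 (hsymm h))⟩
      · exact hp.1 q hq q' hq'
    · rcases Finset.mem_insert.1 hq with rfl | hq
      · obtain ⟨c, hc⟩ := h2 hqr x hx
        exact ⟨c, Finset.mem_insert_of_mem hc⟩
      · obtain ⟨c, hc⟩ := hp.2.1 q hq hqr x hx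
        exact ⟨c, Finset.mem_insert_of_mem hc⟩
    · rcases Finset.mem_insert.1 hx with h | hx
      · cases h
        exact h3 x rfl
      · exact hp.2.2 x c hx
  have key : ∀ p a v, Q p → (¬ ∃ b, (a, b) ∈ p) → (∀ q ∈ p, adj a q.1 → adj v (f q.2)) →
      (a ∉ Set.range g → ∀ x, adj a (g x) → ∃ c, (g x, c) ∈ p) → (∀ x, g x = a → v = s x) →
      ∃ q, p ⊆ q ∧ Q q ∧ ∃ b, (a, b) ∈ q := by
    intro p a v hp ha hv h2 h3
    obtain ⟨w, hw, hW⟩ := hf (p.image Prod.snd) (fun b => ∃ c, (c, b) ∈ p ∧ adj a c) v (by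
      rintro u - ⟨c, hc, hac⟩
      exact hv _ hc hac)
    refine ⟨insert (a, w) p, Finset.subset_insert _ _, add p a w hp (fun q hq => ?_) h2
      (fun x hx => hw.trans (h3 x hx)), w, Finset.mem_insert_self _ _⟩
    have := hW q.2 (Finset.mem_image_of_mem _ hq)
    refine ⟨fun h => ha ⟨q.2, by rw [h]; exact hq⟩, this.1, ?_⟩
    rw [this.2]
    refine ⟨fun h => ⟨q.1, hq, h⟩, fun ⟨c, hc, hac⟩ => ?_⟩
    rwa [← ((hp.1 _ hc _ hq).1.2 rfl)]
  have forth : ∀ p x, Q p → ∃ q, p ⊆ q ∧ Q q ∧ ∃ b, (g x, b) ∈ q := by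
    intro p x hp
    by_cases ha : ∃ b, (g x, b) ∈ p
    · exact ⟨p, subset_rfl, hp, ha⟩
    refine key p (g x) (s x) hp ha (fun q hq hadj => ?_) (fun h => absurd ⟨x, rfl⟩ h)
      (fun y hy => by rw [hginj hy])
    by_cases hr : q.1 ∈ Set.range g
    · obtain ⟨y, hy⟩ := hr
      rw [hp.2.2 y q.2 (by rw [hy]; exact hq)]
      exact hs _ _ ((hgadj _ _).1 (hy ▸ hadj))
    · exact absurd (hp.2.1 q hq hr x (hsymm hadj)) ha
  have forths : ∀ S : Finset G, ∀ p, Q p → ∃ q, p ⊆ q ∧ Q q ∧ ∀ x ∈ S, ∃ b, (g x, b) ∈ q := by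
    intro S
    induction S using Finset.induction_on with
    | empty => exact fun p hp => ⟨p, subset_rfl, hp, by simp⟩
    | insert x S _ ih =>
      intro p hp
      obtain ⟨q, hpq, hq, hS⟩ := ih p hp
      obtain ⟨r, hqr, hr, hx⟩ := forth q x hq
      refine ⟨r, hpq.trans hqr, hr, fun y hy => ?_⟩
      rcases Finset.mem_insert.1 hy with rfl | hy
      · exact hx
      · exact (hS y hy).imp fun b hb => hqr hb
  let T : G ⊕ G → Finset (G × G) → Prop := fun i p =>
    match i with
    | .inl a => ∃ b, (a, b) ∈ p
    | .inr b => ∃ a, (a, b) ∈ p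
  have hT : ∀ i p, Q p → ∃ q, p ⊆ q ∧ Q q ∧ T i q := by
    rintro (a | b) p hp
    · by_cases hr : a ∈ Set.range g
      · obtain ⟨x, rfl⟩ := hr
        exact forth p x hp
      obtain ⟨q, hpq, hq, hS⟩ := forths (hgfin a hr).toFinset p hp
      by_cases ha : ∃ b, (a, b) ∈ q
      · exact ⟨q, hpq, hq, ha⟩
      obtain ⟨v, hv⟩ := hext.exists_adj_iff (q.image fun z => f z.2) (fun _ => True)
      obtain ⟨r, hqr, hr', har⟩ := key q a v hq ha
        (fun z hz _ => (hv _ (Finset.mem_image_of_mem _ hz)).2.2 trivial)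
        (fun _ x hx => hS x (by simpa using hx)) (fun x hx => absurd ⟨x, hx⟩ hr)
      exact ⟨r, hpq.trans hqr, hr', har⟩
    · by_cases hb : ∃ a, (a, b) ∈ p
      · exact ⟨p, subset_rfl, hp, hb⟩
      obtain ⟨u, hu, hW, hfin⟩ := hgext (p.image Prod.fst) (fun a => ∃ c, (a, c) ∈ p ∧ adj b c)
      refine ⟨insert (u, b) p, Finset.subset_insert _ _, add p u b hp (fun q hq => ?_)
        (fun _ x hx => ?_) (fun x hx => absurd ⟨x, hx⟩ hu), u, Finset.mem_insert_self _ _⟩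
      · have := hW q.1 (Finset.mem_image_of_mem _ hq)
        refine ⟨this.1, fun h => hb ⟨q.1, by rw [h]; exact hq⟩, ?_⟩
        rw [this.2]
        refine ⟨fun ⟨c, hc, hac⟩ => ?_, fun h => ⟨q.2, hq, h⟩⟩
        rwa [← ((hp.1 _ hc _ hq).1.1 rfl)]
      · obtain ⟨q, hq, hqx⟩ := Finset.mem_image.1 (hfin x hx)
        exact ⟨q.2, by rw [← hqx]; exact hq⟩
  obtain ⟨σ, hσ, hσ0, hQ, hTσ⟩ := exists_monotone_seq_meeting Q T hT p₀ ⟨hiso, hcl, hval⟩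
  have pair : ∀ m n, ∀ q ∈ σ m, ∀ q' ∈ σ n,
      (q.1 = q'.1 ↔ q.2 = q'.2) ∧ (adj q.1 q'.1 ↔ adj q.2 q'.2) := fun m n q hq q' hq' =>
    (hQ (max m n)).1 q (hσ (le_max_left _ _) hq) q' (hσ (le_max_right _ _) hq')
  choose M t ht using fun a => hTσ (.inl a)
  choose N r hr using fun a => hTσ (.inr a)
  refine ⟨⟨t, r, fun a => (pair _ _ _ (hr (t a)) _ (ht a)).1.2 rfl,
    fun b => (pair _ _ _ (ht (r b)) _ (hr b)).1.1 rfl⟩,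
    fun x y => (pair _ _ _ (ht x) _ (ht y)).2.symm, fun x => (hQ _).2.2 x _ (ht (g x)),
    fun q hq => (pair _ 0 _ (ht q.1) q (hσ0 ▸ hq)).1.1 rfl⟩

open Filter Topology in
/-- A Borel homomorphism from a Baire topological group into a second countable topological monoid
is continuous. -/
theorem MonoidHom.continuous_of_measurable_of_baireSpace {H N : Type*} [Group H]
    [TopologicalSpace H] [IsTopologicalGroup H] [SequentialSpace H] [BaireSpace H]
    [MeasurableSpace H] [BorelSpace H] [Monoid N] [TopologicalSpace N] [ContinuousMul N]
    [SecondCountableTopology N] [MeasurableSpace N] [OpensMeasurableSpace N]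
    (φ : H →* N) (hφ : Measurable φ) : Continuous φ := by
  let B := TopologicalSpace.countableBasis N
  have hB : TopologicalSpace.IsTopologicalBasis B := TopologicalSpace.isBasis_countableBasis N
  have hO : ∀ b ∈ B, ∃ O : Set H, IsOpen O ∧ φ ⁻¹' b =ᶠ[residual H] O := fun b hb =>
    (hφ (hB.isOpen hb).measurableSet).residualEq_isOpen
  choose! O hOo hOe using hO
  have hC : {h | ∀ b ∈ B, h ∈ φ ⁻¹' b ↔ h ∈ O b} ∈ residual H := by
    have : ∀ᶠ h in residual H, ∀ b ∈ B, h ∈ φ ⁻¹' b ↔ h ∈ O b := by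
      rw [eventually_countable_ball (TopologicalSpace.countable_countableBasis N)]
      exact fun b hb => (hOe b hb).mem_iff
    exact this
  set C := {h | ∀ b ∈ B, h ∈ φ ⁻¹' b ↔ h ∈ O b}
  have hshift : ∀ h : H, ∀ᶠ k in residual H, h * k ∈ C := fun h =>
    tendsto_residual_of_isOpenMap (continuous_const_mul h) (isOpenMap_mul_left h) hC
  rw [continuous_iff_seqContinuous]
  intro u h hu
  obtain ⟨k, hk, hkn⟩ : ∃ k, h * k ∈ C ∧ ∀ n, u n * k ∈ C := by
    have : ∀ᶠ k in residual H, h * k ∈ C ∧ ∀ n, u n * k ∈ C :=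
      (hshift h).and (eventually_countable_forall.2 fun n => hshift (u n))
    exact (dense_of_mem_residual this).nonempty
  have h1 : Tendsto (fun n => φ (u n * k)) atTop (𝓝 (φ (h * k))) := by
    rw [hB.nhds_hasBasis.tendsto_right_iff]
    rintro b ⟨hb, hmem⟩
    have := (hu.mul_const k).eventually ((hOo b hb).mem_nhds ((hk b hb).1 hmem))
    filter_upwards [this] with n hn using (hkn n b hb).2 hn
  have h2 := h1.mul_const (φ k⁻¹)
  simpa only [← map_mul, mul_inv_cancel_right, Function.comp_def] using h2

/-- The inverse of a continuous isomorphism `e : N ≃* M` of Polish monoids is continuous on the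
units of `M`, even where `e` is not a homeomorphism. -/
theorem MulEquiv.continuous_symm_comp_units_val {M N : Type*} [Monoid M] [TopologicalSpace M]
    [ContinuousMul M] [PolishSpace M] [Monoid N] [TopologicalSpace N] [ContinuousMul N]
    [PolishSpace N] (e : N ≃* M) (he : Continuous e) :
    Continuous fun u : Mˣ => e.symm (u : M) := by
  borelize M N
  have : PolishSpace Mᵐᵒᵖ := MulOpposite.opHomeomorph.symm.isClosedEmbedding.polishSpace
  have : PolishSpace Mˣ := Units.isClosedEmbedding_embedProduct.polishSpace
  borelize Mˣ
  have hmeas : Measurable e.symm := by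
    intro s hs
    have := (he.measurableEmbedding e.injective).measurableSet_image.2 hs
    rwa [show e.symm ⁻¹' s = e '' s from (e.toEquiv.image_eq_preimage_symm s).symm]
  exact MonoidHom.continuous_of_measurable_of_baireSpace
    (e.symm.toMonoidHom.comp (Units.coeHom M)) (hmeas.comp Units.continuous_val.measurable)

theorem Units.exists_mem_nhds_of_mem_nhds {M : Type*} [Monoid M] [TopologicalSpace M] {t : Mˣ}
    {V : Set Mˣ} (hV : V ∈ nhds t) :
    ∃ A ∈ nhds (t : M), ∃ B ∈ nhds (↑t⁻¹ : M), ∀ u : Mˣ, (u : M) ∈ A → (↑u⁻¹ : M) ∈ B → u ∈ V := by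
  rw [Units.isInducing_embedProduct.nhds_eq_comap] at hV
  obtain ⟨C, hC, hCV⟩ := hV
  rw [Units.embedProduct_apply, nhds_prod_eq] at hC
  obtain ⟨A, hA, B, hB, hAB⟩ := Filter.mem_prod_iff.1 hC
  refine ⟨A, hA, MulOpposite.op ⁻¹' B, MulOpposite.continuous_op.continuousAt hB,
    fun u hu hu' => hCV (hAB ⟨hu, hu'⟩)⟩

theorem MulEquiv.exists_mem_nhds_units_mul_mem {M N : Type*} [Monoid M] [TopologicalSpace M]
    [ContinuousMul M] [PolishSpace M] [Monoid N] [TopologicalSpace N] [ContinuousMul N]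
    [PolishSpace N] (e : N ≃* M) (he : Continuous e) (a b : N) (t : Mˣ) {U : Set N}
    (hU : U ∈ nhds (a * e.symm (t : M) * b)) :
    ∃ A ∈ nhds (t : M), ∃ B ∈ nhds (↑t⁻¹ : M),
      ∀ u : Mˣ, (u : M) ∈ A → (↑u⁻¹ : M) ∈ B → a * e.symm (u : M) * b ∈ U := by
  have h : Continuous fun u : Mˣ => a * e.symm (u : M) * b :=
    (continuous_const.mul (e.continuous_symm_comp_units_val he)).mul continuous_const
  exact Units.exists_mem_nhds_of_mem_nhds (h.continuousAt hU)

instance graphEnd.instMonoid (adj : G → G → Prop) : Monoid ↥(graphEnd adj) where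
  mul a b := ⟨b.1 ∘ a.1, graphEnd_comp adj a.1 a.2 b.1 b.2⟩
  one := ⟨id, fun _ _ h => h⟩
  mul_assoc _ _ _ := rfl
  one_mul _ := rfl
  mul_one _ := rfl

theorem isOpen_pointwiseTop_eval {X : Type*} (S : Set (X → X)) (x y : X) :
    @IsOpen _ (pointwiseTop X S) {f : ↥S | f.1 x = y} :=
  TopologicalSpace.isOpen_generateFrom_of_mem ⟨x, y, rfl⟩

theorem pointwiseTop_eq_induced (X : Type*) (S : Set (X → X)) :
    pointwiseTop X S =
      (@Pi.topologicalSpace X (fun _ => X) fun _ => ⊥).induced Subtype.val := by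
  let _ : TopologicalSpace X := ⊥
  have : DiscreteTopology X := ⟨rfl⟩
  apply le_antisymm
  · rw [← continuous_iff_le_induced]
    let _ := pointwiseTop X S
    refine continuous_pi fun x => continuous_discrete_rng.2 fun y => ?_
    exact isOpen_pointwiseTop_eval S x y
  · refine le_generateFrom ?_
    rintro U ⟨x, y, rfl⟩
    exact ⟨_, (isOpen_discrete {y}).preimage (continuous_apply x), rfl⟩

theorem polishSpace_pointwiseTop_graphEnd [Countable G] (adj : G → G → Prop) :
    @PolishSpace _ (pointwiseTop G (graphEnd adj)) := by
  let _ : TopologicalSpace G := ⊥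
  have : DiscreteTopology G := ⟨rfl⟩
  have hclosed : IsClosed (graphEnd adj) := by
    simp only [graphEnd, Set.ofPred_forall]
    refine isClosed_iInter fun x => isClosed_iInter fun y => isClosed_iInter fun _ => ?_
    have h : Continuous fun f : G → G => (f x, f y) := by fun_prop
    exact (isClosed_discrete {q : G × G | adj q.1 q.2}).preimage h
  rw [pointwiseTop_eq_induced]
  have : PolishSpace G := inferInstance
  have : PolishSpace (G → G) := inferInstance
  exact hclosed.polishSpace

theorem continuous_comp_pointwiseTop {X : Type*} {S : Set (X → X)}
    (hS : ∀ f ∈ S, ∀ g ∈ S, g ∘ f ∈ S) :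
    letI := pointwiseTop X S
    Continuous fun p : ↥S × ↥S => (⟨p.2.1 ∘ p.1.1, hS p.1.1 p.1.2 p.2.1 p.2.2⟩ : ↥S) := by
  let _ := pointwiseTop X S
  refine continuous_generateFrom_iff.2 ?_
  rintro _ ⟨x, z, rfl⟩
  have : (fun p : ↥S × ↥S => (⟨p.2.1 ∘ p.1.1, hS p.1.1 p.1.2 p.2.1 p.2.2⟩ : ↥S)) ⁻¹'
      {f : ↥S | f.1 x = z} = ⋃ y, {f : ↥S | f.1 x = y} ×ˢ {f : ↥S | f.1 y = z} := by
    ext p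
    simp
  rw [this]
  exact isOpen_iUnion fun y =>
    (isOpen_pointwiseTop_eval S x y).prod (isOpen_pointwiseTop_eval S y z)

theorem exists_finset_of_mem_nhds_pointwiseTop {X : Type*} {S : Set (X → X)} {m : ↥S}
    {A : Set ↥S} (hA : A ∈ @nhds _ (pointwiseTop X S) m) :
    ∃ F : Finset X, ∀ m' : ↥S, (∀ x ∈ F, m'.1 x = m.1 x) → m' ∈ A := by
  let _ : TopologicalSpace X := ⊥
  have : DiscreteTopology X := ⟨rfl⟩
  rw [pointwiseTop_eq_induced, nhds_induced, nhds_pi] at hA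
  obtain ⟨B, hB, hBA⟩ := hA
  obtain ⟨I, V, hV, hIB⟩ := Filter.mem_pi'.1 hB
  refine ⟨I, fun m' hm' => hBA (hIB fun x hx => ?_)⟩
  rw [hm' x hx]
  exact mem_of_mem_nhds (hV x)

theorem mem_nhds_pointwiseTop {X : Type*} {S : Set (X → X)} {m : ↥S} {A : Set ↥S} (F : Finset X)
    (h : ∀ m' : ↥S, (∀ x ∈ F, m'.1 x = m.1 x) → m' ∈ A) :
    A ∈ @nhds _ (pointwiseTop X S) m := by
  let _ := pointwiseTop X S
  have : ∀ᶠ m' in nhds m, ∀ x ∈ F, m'.1 x = m.1 x := by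
    rw [Filter.eventually_all_finset]
    exact fun x _ => (isOpen_pointwiseTop_eval S x _).mem_nhds rfl
  exact Filter.mem_of_superset this h

/-- Every Hausdorff semigroup topology on the endomorphism monoid of the random graph is finer
than the pointwise topology. -/
theorem le_pointwiseTop_graphEnd [Countable G] {adj : G → G → Prop}
    (hsymm : ∀ ⦃x y⦄, adj x y → adj y x) (hirr : ∀ x, ¬ adj x x) (hext : ExtensionProperty adj)
    (τ : TopologicalSpace ↥(graphEnd adj)) [T2Space ↥(graphEnd adj)]
    [ContinuousMul ↥(graphEnd adj)] : τ ≤ pointwiseTop G (graphEnd adj) := by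
  classical
  obtain ⟨e, he⟩ := exists_injective_nat G
  have clique : ∀ x : G, ∃ c : ℕ → G, (∀ n, adj (c n) x) ∧ ∀ m n, m ≠ n → adj (c m) (c n) := by
    intro x
    obtain ⟨c, hc, hmn⟩ := exists_seq_of_forall_finset_exists (fun y => adj y x) adj (by
      intro s _
      obtain ⟨w, hw⟩ := hext.exists_adj_iff (insert x s) (fun _ => True)
      exact ⟨w, (hw x (by simp)).2.2 trivial,
        fun y hy => hsymm ((hw y (by simp [hy])).2.2 trivial)⟩)
    refine ⟨c, hc, fun m n h => ?_⟩
    rcases lt_or_gt_of_ne h with h | h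
    · exact hmn m n h
    · exact hsymm (hmn n m h)
  have hend : ∀ (c : ℕ → G), (∀ m n, m ≠ n → adj (c m) (c n)) → ∀ i : G → ℕ,
      Function.Injective i → (fun z => c (i z)) ∈ graphEnd adj := by
    intro c hc i hi a b hab
    exact hc _ _ fun h => hirr a (by rw [← hi h] at hab; exact hab)
  refine le_generateFrom ?_
  rintro _ ⟨x, y, rfl⟩
  obtain ⟨c, hcx, hc⟩ := clique x
  let γ (k : ℕ) : ↥(graphEnd adj) := ⟨fun z => if z = x then x else c (2 * e z + k), by
    intro a b hab
    have hne : a ≠ b := fun h => hirr a (by rw [← h] at hab; exact hab)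
    have hne' : e a ≠ e b := fun h => hne (he h)
    by_cases ha : a = x <;> by_cases hb : b = x
    · exact absurd (ha.trans hb.symm) hne
    · simpa [ha, hb] using hsymm (hcx _)
    · simpa [ha, hb] using hcx _
    · simpa [ha, hb] using hc _ _ (by omega)⟩
  let α : ↥(graphEnd adj) := ⟨fun z => c (e z + 1), hend c hc _ fun a b h => he (by simpa using h)⟩
  let β : ↥(graphEnd adj) := ⟨fun z => c (if z = y then 0 else e z + 1), hend c hc _ (by
    intro a b h
    by_cases ha : a = y <;> by_cases hb : b = y <;> simp [ha, hb] at h ⊢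
    exact he h)⟩
  have hαβ : α.1 y ≠ β.1 y := by
    intro h
    have h' : c (e y + 1) = c 0 := by simpa [α, β] using h
    have := hc (e y + 1) 0 (by omega)
    rw [h'] at this
    exact hirr _ this
  have hαβ' : ∀ z, z ≠ y → α.1 z = β.1 z := fun z hz => by simp [α, β, hz]
  have hset : {f : ↥(graphEnd adj) | f.1 x = y} =
      {f | γ 0 * f * α ≠ γ 0 * f * β} ∩ {f | γ 1 * f * α ≠ γ 1 * f * β} := by
    ext f
    have hfix : ∀ k, (γ k).1 x = x := fun k => by simp [γ]
    have hout : ∀ k, γ k * f * α ≠ γ k * f * β → ∃ z, f.1 ((γ k).1 z) = y := by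
      intro k h
      by_contra! hz
      exact h (Subtype.ext (funext fun z => hαβ' _ (hz z)))
    constructor
    · intro hf
      have (k : ℕ) : γ k * f * α ≠ γ k * f * β := by
        intro h
        have h' : α.1 (f.1 ((γ k).1 x)) = β.1 (f.1 ((γ k).1 x)) :=
          congrFun (congrArg Subtype.val h) x
        rw [hfix, show f.1 x = y from hf] at h'
        exact hαβ h'
      exact ⟨this 0, this 1⟩
    · rintro ⟨h0, h1⟩
      obtain ⟨z, hz⟩ := hout 0 h0
      obtain ⟨w, hw⟩ := hout 1 h1
      by_cases hzx : z = x
      · rw [hzx, hfix] at hz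
        exact hz
      by_cases hwx : w = x
      · rw [hwx, hfix] at hw
        exact hw
      have hadj : adj ((γ 0).1 z) ((γ 1).1 w) := by
        simpa [γ, hzx, hwx] using hc (2 * e z) (2 * e w + 1) (by omega)
      have := f.2 _ _ hadj
      rw [hz, hw] at this
      exact absurd this (hirr y)
  rw [hset]
  exact (isOpen_ne_fun (by fun_prop) (by fun_prop)).inter
    (isOpen_ne_fun (by fun_prop) (by fun_prop))

/-- Every Polish semigroup topology on the endomorphism monoid of the random graph that is finer
than the pointwise topology is equal to it. -/
theorem pointwiseTop_graphEnd_le [Countable G] {adj : G → G → Prop}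
    (hsymm : ∀ ⦃x y⦄, adj x y → adj y x) (hirr : ∀ x, ¬ adj x x) (hext : ExtensionProperty adj)
    (τ : TopologicalSpace ↥(graphEnd adj)) [PolishSpace ↥(graphEnd adj)]
    [ContinuousMul ↥(graphEnd adj)] (hτ : τ ≤ pointwiseTop G (graphEnd adj)) :
    pointwiseTop G (graphEnd adj) ≤ τ := by
  classical
  obtain ⟨f, hfend, hf⟩ := hext.exists_generic_end hsymm hirr
  obtain ⟨g, hginj, hgadj, hgfin, hgext⟩ := hext.exists_sparse_embedding hsymm hirr
  have factor : ∀ s : ↥(graphEnd adj), ∀ p₀ : Finset (G × G),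
      (∀ q ∈ p₀, ∀ q' ∈ p₀, (q.1 = q'.1 ↔ q.2 = q'.2) ∧ (adj q.1 q'.1 ↔ adj q.2 q'.2)) →
      (∀ q ∈ p₀, q.1 ∉ Set.range g → ∀ x, adj q.1 (g x) → ∃ b, (g x, b) ∈ p₀) →
      (∀ x b, (g x, b) ∈ p₀ → f b = s.1 x) →
      ∃ t : (↥(graphEnd adj))ˣ,
        (⟨g, fun x y h => (hgadj x y).2 h⟩ * t.1 * ⟨f, hfend⟩ : ↥(graphEnd adj)) = s ∧
        ∀ q ∈ p₀, t.1.1 q.1 = q.2 := by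
    intro s p₀ h1 h2 h3
    obtain ⟨t, ht, hts, htp⟩ := exists_automorphism_factorization hsymm hirr hext s.2 hf hginj hgadj
      hgfin hgext p₀ h1 h2 h3
    refine ⟨⟨⟨t, fun x y h => (ht x y).2 h⟩, ⟨t.symm, fun x y h => ?_⟩,
      Subtype.ext (funext t.symm_apply_apply), Subtype.ext (funext t.apply_symm_apply)⟩,
      Subtype.ext (funext hts), htp⟩
    rw [← ht]
    simpa using h
  let g₀ : ↥(graphEnd adj) := ⟨g, fun x y h => (hgadj x y).2 h⟩
  let f₀ : ↥(graphEnd adj) := ⟨f, hfend⟩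
  rw [le_iff_nhds]
  intro s U hU
  obtain ⟨t, hts, -⟩ := factor s ∅ (by simp) (by simp) (by simp)
  obtain ⟨A, hA, B, hB, hAB⟩ := @MulEquiv.exists_mem_nhds_units_mul_mem _ _ _
    (pointwiseTop G (graphEnd adj))
    (@ContinuousMul.mk _ (_) _ (continuous_comp_pointwiseTop (graphEnd_comp adj)))
    (polishSpace_pointwiseTop_graphEnd adj) _ τ _ _ (MulEquiv.refl _) (continuous_id_iff_le.2 hτ)
    g₀ f₀ t U (by
      change U ∈ nhds (g₀ * t.1 * f₀)
      rwa [hts])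
  obtain ⟨F, hF⟩ := exists_finset_of_mem_nhds_pointwiseTop hA
  obtain ⟨F', hF'⟩ := exists_finset_of_mem_nhds_pointwiseTop hB
  have hinv (u : (↥(graphEnd adj))ˣ) (x : G) : (u⁻¹).1.1 (u.1.1 x) = x :=
    congrFun (congrArg Subtype.val u.mul_inv) x
  have hinv' (u : (↥(graphEnd adj))ˣ) (x : G) : u.1.1 ((u⁻¹).1.1 x) = x :=
    congrFun (congrArg Subtype.val u.inv_mul) x
  let D₀ : Finset G := F ∪ F'.image (t⁻¹).1.1
  let D : Finset G := D₀ ∪ D₀.biUnion fun a =>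
    if h : a ∉ Set.range g then (hgfin a h).toFinset.image g else ∅
  have hD : ∀ a ∈ D, a ∉ Set.range g → ∀ x, adj a (g x) → g x ∈ D := by
    intro a ha har x hx
    have ha₀ : a ∈ D₀ := by
      rcases Finset.mem_union.1 ha with ha | ha
      · exact ha
      · obtain ⟨b, -, hb⟩ := Finset.mem_biUnion.1 ha
        split_ifs at hb with h
        · simp at hb
        · obtain ⟨y, -, hy⟩ := Finset.mem_image.1 hb
          exact absurd ⟨y, hy⟩ har
    refine Finset.mem_union_right _ (Finset.mem_biUnion.2 ⟨a, ha₀, ?_⟩)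
    rw [dif_pos har]
    exact Finset.mem_image_of_mem _ (by simpa using hx)
  refine mem_nhds_pointwiseTop (D.preimage g hginj.injOn) fun s' hs' => ?_
  obtain ⟨t', hts', ht'⟩ := factor s' (D.image fun a => (a, t.1.1 a)) (by
      simp only [Finset.mem_image]
      rintro _ ⟨a, -, rfl⟩ _ ⟨b, -, rfl⟩
      refine ⟨⟨fun h => congrArg t.1.1 h, fun h => ?_⟩, fun h => t.1.2 _ _ h, fun h => ?_⟩
      · have := congrArg (t⁻¹).1.1 h
        rwa [hinv, hinv] at this
      · have := (t⁻¹).1.2 _ _ h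
        simpa only [hinv] using this) (by
      simp only [Finset.mem_image]
      rintro _ ⟨a, ha, rfl⟩ har x hx
      exact ⟨_, g x, hD a ha har x hx, rfl⟩) (by
      intro x b hb
      obtain ⟨a, ha, hab⟩ := Finset.mem_image.1 hb
      cases hab
      rw [hs' x (by simpa using ha), ← hts]
      rfl)
  have hagree : ∀ a ∈ D, t'.1.1 a = t.1.1 a := fun a ha =>
    ht' _ (Finset.mem_image_of_mem (fun a => (a, t.1.1 a)) ha)
  have hmem := hAB t' (hF _ fun x hx => hagree x (by simp [D, D₀, hx])) (hF' _ fun y hy => by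
    have := hagree _ (Finset.mem_union_left _ (Finset.mem_union_right _
      (Finset.mem_image_of_mem (t⁻¹).1.1 hy)))
    rw [hinv'] at this
    conv_lhs => rw [← this]
    exact hinv t' _)
  have : g₀ * t'.1 * f₀ ∈ U := hmem
  rwa [hts'] at this

theorem randomGraph_unique_polish_semigroup_topology
    [Countable G] (adj : G → G → Prop)
    (hsymm : Symmetric adj) (hirr : Irreflexive adj)
    (hext : ExtensionProperty adj) :
    IsPolishSemigroupTop (graphEnd_comp adj) (pointwiseTop G (graphEnd adj)) ∧
      ∀ τ : TopologicalSpace ↥(graphEnd adj),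
        IsPolishSemigroupTop (graphEnd_comp adj) τ →
        τ = pointwiseTop G (graphEnd adj) := by
  refine ⟨⟨polishSpace_pointwiseTop_graphEnd adj,
    continuous_comp_pointwiseTop (graphEnd_comp adj)⟩, fun τ hτ => ?_⟩
  have := hτ.1
  have : ContinuousMul ↥(graphEnd adj) := ⟨hτ.2⟩
  have hsymm' : ∀ ⦃x y⦄, adj x y → adj y x := fun _ _ h => hsymm h
  have hle := le_pointwiseTop_graphEnd hsymm' hirr hext τ
  exact le_antisymm hle (pointwiseTop_graphEnd_le hsymm' hirr hext τ hle)
end
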